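/- Let X be a systolic chamber complex of dimension n ≥ 1, τ a simplex of X, and σ an (n−1)-dimensional simplex of the combinatorial sphere S_k(τ,X). Then there exists a vertex v at combinatorial distance k+1 from τ such that v ∗ σ is a simplex of X. -/

import Mathlib

universe u

/-- An abstract simplicial complex on a vertex type `V`: a downward-closed
family of nonempty finite subsets of `V`. -/
structure SComplex (V : Type u) where
  faces : Set (Finset V)
  nonempty_of_mem : ∀ σ ∈ faces, σ.Nonempty
  down_closed : ∀ σ ∈ faces, ∀ τ : Finset V, τ ⊆ σ → τ.Nonempty → τ ∈ faces

namespace SComplex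

variable {V : Type u} [DecidableEq V]

/-- The vertex set of a simplicial complex. -/
def vertexSet (X : SComplex V) : Set V := {v | ({v} : Finset V) ∈ X.faces}

/-- The geometric realization of a simplicial complex: the set of barycentric
coordinate functions supported on a simplex, inside the product space `V → ℝ`. -/
def realization (X : SComplex V) : Set (V → ℝ) :=
  {f | (∀ v, 0 ≤ f v) ∧ ∃ σ ∈ X.faces, (∀ v, v ∉ σ → f v = 0) ∧ ∑ v ∈ σ, f v = 1}

/-- `Y` is a subcomplex of `X`. -/
def IsSubcomplexOf (Y X : SComplex V) : Prop := Y.faces ⊆ X.faces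

/-- `Y` is a full subcomplex of `X`. -/
def IsFullSubcomplexOf (Y X : SComplex V) : Prop :=
  Y.faces ⊆ X.faces ∧
    ∀ σ ∈ X.faces, (∀ v ∈ σ, ({v} : Finset V) ∈ Y.faces) → σ ∈ Y.faces

/-- The full subcomplex of `X` spanned by a set `W` of vertices. -/
def restrict (X : SComplex V) (W : Set V) : SComplex V where
  faces := {σ | σ ∈ X.faces ∧ ∀ v ∈ σ, v ∈ W}
  nonempty_of_mem := fun σ h => X.nonempty_of_mem σ h.1
  down_closed := fun σ h τ hτ hne =>
    ⟨X.down_closed σ h.1 τ hτ hne, fun v hv => h.2 v (hτ hv)⟩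

/-- The link of a simplex `σ` in `X`. -/
def link (X : SComplex V) (σ : Finset V) : SComplex V where
  faces := {τ | τ ∈ X.faces ∧ Disjoint τ σ ∧ τ ∪ σ ∈ X.faces}
  nonempty_of_mem := fun τ h => X.nonempty_of_mem τ h.1
  down_closed := by
    rintro τ ⟨hτ, hdisj, hunion⟩ ρ hρ hne
    refine ⟨X.down_closed τ hτ ρ hρ hne, ?_, ?_⟩
    · exact Finset.disjoint_left.mpr fun a ha hb => Finset.disjoint_left.mp hdisj (hρ ha) hb
    · exact X.down_closed _ hunion _ (Finset.union_subset_union hρ (subset_refl σ))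
        (hne.mono Finset.subset_union_left)

/-- A combinatorial cycle of length `m` in `X` (a subcomplex homeomorphic to a circle):
an injective enumeration of `m` vertices, consecutive ones joined by edges of `X`. -/
def IsCycle (X : SComplex V) (m : ℕ) (γ : ZMod m → V) : Prop :=
  3 ≤ m ∧ Function.Injective γ ∧ ∀ i : ZMod m, ({γ i, γ (i + 1)} : Finset V) ∈ X.faces

/-- The cycle `γ` has a diagonal: an edge of `X` joining two nonconsecutive vertices. -/
def HasDiagonal (X : SComplex V) (m : ℕ) (γ : ZMod m → V) : Prop :=
  ∃ i j : ZMod m, j ≠ i ∧ j ≠ i + 1 ∧ j ≠ i - 1 ∧ ({γ i, γ j} : Finset V) ∈ X.faces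

/-- A simplicial complex is flag if every finite set of vertices pairwise joined
by edges spans a simplex. -/
def Flag (X : SComplex V) : Prop :=
  ∀ A : Finset V, A.Nonempty → (∀ v ∈ A, ({v} : Finset V) ∈ X.faces) →
    (∀ v ∈ A, ∀ w ∈ A, v ≠ w → ({v, w} : Finset V) ∈ X.faces) → A ∈ X.faces

/-- A simplicial complex is `k`-large if it is flag and every cycle of length
`4 ≤ |γ| < k` has a diagonal. -/
def KLarge (k : ℕ) (X : SComplex V) : Prop :=
  X.Flag ∧ ∀ (m : ℕ) (γ : ZMod m → V), X.IsCycle m γ → 4 ≤ m → m < k → X.HasDiagonal m γ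

/-- A simplicial complex is locally `k`-large if all links of its (nonempty) simplices
are `k`-large. -/
def LocallyKLarge (k : ℕ) (X : SComplex V) : Prop :=
  ∀ σ ∈ X.faces, KLarge k (X.link σ)

/-- A systolic complex: connected, simply connected and locally `6`-large. -/
def Systolic (X : SComplex V) : Prop :=
  LocallyKLarge 6 X ∧ ConnectedSpace X.realization ∧ SimplyConnectedSpace X.realization

/-- A simplicial complex is locally finite if every vertex belongs to finitely
many simplices. -/
def LocallyFinite (X : SComplex V) : Prop :=
  ∀ v : V, {σ ∈ X.faces | v ∈ σ}.Finite

/-- The faces of the closed combinatorial ball of radius `i` around the simplex `σ`: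
`B_0 = σ` and `B_{i+1}` is the union of all closed simplices meeting `B_i`. -/
def ballFaces (X : SComplex V) (σ : Finset V) : ℕ → Set (Finset V)
  | 0 => {τ | τ ∈ X.faces ∧ τ ⊆ σ}
  | i + 1 => {ρ | ρ ∈ X.faces ∧ ∃ τ ∈ X.faces, ρ ⊆ τ ∧
      ∃ v ∈ τ, ({v} : Finset V) ∈ X.ballFaces σ i}

/-- The closed combinatorial ball of radius `i` around `σ`, as a subcomplex. -/
def ball (X : SComplex V) (σ : Finset V) (i : ℕ) : SComplex V where
  faces := X.ballFaces σ i
  nonempty_of_mem := by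
    cases i with
    | zero => exact fun τ h => X.nonempty_of_mem τ h.1
    | succ n => exact fun τ h => X.nonempty_of_mem τ h.1
  down_closed := by
    cases i with
    | zero => exact fun τ h ρ hsub hne =>
        ⟨X.down_closed τ h.1 ρ hsub hne, hsub.trans h.2⟩
    | succ n =>
        rintro τ ⟨hτ, μ, hμ, hsub2, v, hv, hball⟩ ρ hsub hne
        exact ⟨X.down_closed τ hτ ρ hsub hne, μ, hμ, hsub.trans hsub2, v, hv, hball⟩

/-- The faces of the combinatorial sphere of radius `i` around `σ`: the faces of the
ball `B_i` all of whose vertices are at combinatorial distance exactly `i` from `σ`. -/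
def sphereFaces (X : SComplex V) (σ : Finset V) : ℕ → Set (Finset V)
  | 0 => X.ballFaces σ 0
  | i + 1 => {τ | τ ∈ X.ballFaces σ (i + 1) ∧
      ∀ v ∈ τ, ({v} : Finset V) ∉ X.ballFaces σ i}

/-- The combinatorial sphere of radius `i` around `σ`, as a subcomplex: the subcomplex
of `B_i` spanned by the vertices at combinatorial distance `i` from `σ`. -/
def sphere (X : SComplex V) (σ : Finset V) (i : ℕ) : SComplex V where
  faces := X.sphereFaces σ i
  nonempty_of_mem := by
    cases i with
    | zero => exact fun τ h => (X.ball σ 0).nonempty_of_mem τ h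
    | succ n => exact fun τ h => (X.ball σ (n + 1)).nonempty_of_mem τ h.1
  down_closed := by
    cases i with
    | zero => exact fun τ h ρ hsub hne => (X.ball σ 0).down_closed τ h ρ hsub hne
    | succ n =>
        rintro τ ⟨hτ, hout⟩ ρ hsub hne
        exact ⟨(X.ball σ (n + 1)).down_closed τ hτ ρ hsub hne,
          fun v hv => hout v (hsub hv)⟩

/-- The condition `R(v,X)`: for every simplex `σ` of the link `X_v`, the complement
in `X_v` of the open combinatorial ball of radius `2` around `σ` (i.e. the full
subcomplex of `X_v` spanned by the vertices at combinatorial distance at least `2`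
from `σ`) is connected. -/
def CondR (X : SComplex V) (v : V) : Prop :=
  ∀ σ ∈ (X.link {v}).faces,
    ConnectedSpace
      ((X.link {v}).restrict
        {w | ({w} : Finset V) ∉ (X.link {v}).ballFaces σ 1}).realization

/-- A chamber complex of dimension `n`: every simplex is contained in a simplex with
`n+1` vertices (a chamber), there are no larger simplices, and every codimension-one
face lies in at least two chambers. -/
def IsChamberComplex (X : SComplex V) (n : ℕ) : Prop :=
  (∀ σ ∈ X.faces, σ.card ≤ n + 1) ∧
  (∀ σ ∈ X.faces, ∃ τ ∈ X.faces, σ ⊆ τ ∧ τ.card = n + 1) ∧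
  (∀ σ ∈ X.faces, σ.card = n →
    ∃ τ₁ ∈ X.faces, ∃ τ₂ ∈ X.faces, τ₁ ≠ τ₂ ∧ σ ⊆ τ₁ ∧ σ ⊆ τ₂ ∧
      τ₁.card = n + 1 ∧ τ₂.card = n + 1)

/-- Two chambers of an `n`-dimensional chamber complex are adjacent if they share a
codimension-one face. -/
def ChamberAdj (X : SComplex V) (n : ℕ) (σ τ : Finset V) : Prop :=
  σ ∈ X.faces ∧ τ ∈ X.faces ∧ σ.card = n + 1 ∧ τ.card = n + 1 ∧
    ∃ ρ ∈ X.faces, ρ.card = n ∧ ρ ⊆ σ ∧ ρ ⊆ τ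

/-- A chamber complex is gallery connected if any two chambers are joined by a gallery. -/
def GalleryConnected (X : SComplex V) (n : ℕ) : Prop :=
  ∀ σ ∈ X.faces, σ.card = n + 1 → ∀ τ ∈ X.faces, τ.card = n + 1 →
    Relation.ReflTransGen (X.ChamberAdj n) σ τ

/-- A normal chamber complex: gallery connected, with all links of dimension above `0`
gallery connected. -/
def IsNormalChamberComplex (X : SComplex V) (n : ℕ) : Prop :=
  IsChamberComplex X n ∧ GalleryConnected X n ∧
    ∀ σ ∈ X.faces, σ.card ≤ n - 1 → GalleryConnected (X.link σ) (n - σ.card)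

/-- A pseudomanifold of dimension `n`: a chamber complex in which every codimension-one
face belongs to exactly two chambers. -/
def IsPseudomanifold (X : SComplex V) (n : ℕ) : Prop :=
  IsChamberComplex X n ∧
    ∀ σ ∈ X.faces, σ.card = n →
      ({τ | τ ∈ X.faces ∧ σ ⊆ τ ∧ τ.card = n + 1} : Set (Finset V)).ncard = 2

/-- The dimension of a (finite-dimensional) simplicial complex. -/
noncomputable def dim (X : SComplex V) : ℕ := sSup {n : ℕ | ∃ σ ∈ X.faces, σ.card = n + 1}

/-- A simplicial complex is finite dimensional. -/
def IsFiniteDimensional (X : SComplex V) : Prop :=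
  ∃ N : ℕ, ∀ σ ∈ X.faces, σ.card ≤ N + 1

end SComplex

namespace SComplex

open Topology

section Covering

variable {V : Type*} [DecidableEq V] {P : Type*}

/-- The data of a covering of the `2`-skeleton of `X`: a reflexive neighbour relation `N` on `P`
and a labelling `p : P → V` which is bijective on neighbourhoods and lifts triangles. -/
structure IsCombCover (X : SComplex V) (p : P → V) (N : P → P → Prop) : Prop where
  refl : ∀ x, N x x
  symm : ∀ x y, N x y → N y x
  edge : ∀ x y, N x y → ({p x, p y} : Finset V) ∈ X.faces
  exists_lift : ∀ x b, ({p x, b} : Finset V) ∈ X.faces → ∃ y, N x y ∧ p y = b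
  lift_unique : ∀ x y z, N x y → N x z → p y = p z → y = z
  triangle : ∀ x y z, N x y → N x z → ({p x, p y, p z} : Finset V) ∈ X.faces → N y z

variable {X : SComplex V} {p : P → V} {N : P → P → Prop}

/-- The function on `P` which lifts `f : V → ℝ` to the star of `x`. -/
noncomputable def starLift (p : P → V) (N : P → P → Prop) (x : P) (f : V → ℝ) : P → ℝ :=
  open Classical in fun y => if N x y then f (p y) else 0

omit [DecidableEq V] in
lemma starLift_of_rel {x y : P} (h : N x y) (f : V → ℝ) : starLift p N x f y = f (p y) := by
  simp [starLift, h]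

omit [DecidableEq V] in
lemma starLift_of_not_rel {x y : P} (h : ¬ N x y) (f : V → ℝ) : starLift p N x f y = 0 := by
  simp [starLift, h]

omit [DecidableEq V] in
lemma continuous_starLift (x : P) : Continuous (starLift p N x) := by
  refine continuous_pi fun y => ?_
  unfold starLift
  split_ifs
  · exact continuous_apply _
  · exact continuous_const

omit [DecidableEq V] in
lemma faces_mono {σ ρ : Finset V} (hσ : σ ∈ X.faces) (h : ρ ⊆ σ) (hne : ρ.Nonempty) :
    ρ ∈ X.faces := X.down_closed σ hσ ρ h hne

omit [DecidableEq V] in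
lemma exists_pos_of_mem_realization {f : V → ℝ} (hf : f ∈ X.realization) : ∃ v, 0 < f v := by
  obtain ⟨h0, σ, hσ, -, hsum⟩ := hf
  by_contra! h
  have : ∑ v ∈ σ, f v ≤ 0 := Finset.sum_nonpos fun v _ => h v
  linarith

lemma IsCombCover.starLift_eq (h : IsCombCover X p N) {f : V → ℝ} {σ : Finset V}
    (hσ : σ ∈ X.faces) (hf : ∀ v, v ∉ σ → f v = 0) {x y : P} (hxy : N x y) (hx : p x ∈ σ)
    (hy : p y ∈ σ) : starLift p N x f = starLift p N y f := by
  funext z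
  by_cases hz : p z ∈ σ
  · have key : N x z ↔ N y z := by
      constructor
      · intro hz'
        refine h.triangle x y z hxy hz' (faces_mono hσ ?_ (by simp))
        simp [Finset.insert_subset_iff, hx, hy, hz]
      · intro hz'
        refine h.triangle y x z (h.symm _ _ hxy) hz' (faces_mono hσ ?_ (by simp))
        simp [Finset.insert_subset_iff, hx, hy, hz]
    by_cases hxz : N x z
    · rw [starLift_of_rel hxz, starLift_of_rel (key.1 hxz)]
    · rw [starLift_of_not_rel hxz, starLift_of_not_rel fun hc => hxz (key.2 hc)]
  · by_cases hxz : N x z <;> by_cases hyz : N y z <;>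
      simp [starLift_of_rel, starLift_of_not_rel, hxz, hyz, hf _ hz]

/-- The total space of the covering of `X.realization` associated with a combinatorial covering:
pairs of a point of the realization and its lift to a star. -/
def totalSpace (X : SComplex V) (p : P → V) (N : P → P → Prop) : Set ((V → ℝ) × (P → ℝ)) :=
  {q | q.1 ∈ X.realization ∧ ∃ x, 0 < q.1 (p x) ∧ q.2 = starLift p N x q.1}

/-- The projection of the total space to the realization. -/
def totalProj (X : SComplex V) (p : P → V) (N : P → P → Prop) (q : totalSpace X p N) :
    X.realization := ⟨q.1.1, q.2.1⟩

omit [DecidableEq V] in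
lemma continuous_totalProj : Continuous (totalProj X p N) := by
  unfold totalProj
  fun_prop

lemma IsCombCover.mk_mem_totalSpace (h : IsCombCover X p N) {f : V → ℝ} (hf : f ∈ X.realization)
    {σ : Finset V} (hσ : σ ∈ X.faces) (hfσ : ∀ v, v ∉ σ → f v = 0) {x : P} (hx : p x ∈ σ) :
    (f, starLift p N x f) ∈ totalSpace X p N := by
  obtain ⟨v, hv⟩ := exists_pos_of_mem_realization hf
  have hvσ : v ∈ σ := by
    by_contra hc
    exact hv.ne' (hfσ v hc)
  obtain ⟨y, hxy, rfl⟩ := h.exists_lift x v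
    (faces_mono hσ (by simp [Finset.insert_subset_iff, hx, hvσ]) (by simp))
  exact ⟨hf, y, hv, h.starLift_eq hσ hfσ hxy hx hvσ⟩

lemma IsCombCover.existsUnique_pos (h : IsCombCover X p N) (q : totalSpace X p N) {v : V}
    (hv : 0 < q.1.1 v) :
    ∃ y, p y = v ∧ q.1.2 = starLift p N y q.1.1 ∧ ∀ z, p z = v → 0 < q.1.2 z → z = y := by
  obtain ⟨⟨f, g⟩, hf, x, hx, hg⟩ := q
  dsimp only at *
  obtain ⟨h0, σ, hσ, hfσ, hsum⟩ := hf
  have mem : ∀ w, 0 < f w → w ∈ σ := fun w hw => by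
    by_contra hc
    exact hw.ne' (hfσ w hc)
  obtain ⟨y, hxy, rfl⟩ := h.exists_lift x v
    (faces_mono hσ (by simp [Finset.insert_subset_iff, mem _ hx, mem _ hv]) (by simp))
  refine ⟨y, rfl, hg.trans (h.starLift_eq hσ hfσ hxy (mem _ hx) (mem _ hv)), fun z hz hpos => ?_⟩
  have hxz : N x z := by
    by_contra hc
    rw [show g z = 0 from (congrFun hg z).trans (starLift_of_not_rel hc f)] at hpos
    exact hpos.false
  exact h.lift_unique x z y hxz hxy hz

/-- The sheet over the open star of `v` containing a point of the total space. -/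
noncomputable def IsCombCover.sheet (h : IsCombCover X p N) (v : V)
    (q : {q : totalSpace X p N // 0 < q.1.1 v}) : {y : P // p y = v} :=
  ⟨(h.existsUnique_pos q.1 q.2).choose, (h.existsUnique_pos q.1 q.2).choose_spec.1⟩

lemma IsCombCover.starLift_sheet (h : IsCombCover X p N) (v : V)
    (q : {q : totalSpace X p N // 0 < q.1.1 v}) :
    q.1.1.2 = starLift p N (h.sheet v q) q.1.1.1 :=
  (h.existsUnique_pos q.1 q.2).choose_spec.2.1

lemma IsCombCover.sheet_eq_iff (h : IsCombCover X p N) (v : V)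
    (q : {q : totalSpace X p N // 0 < q.1.1 v}) (y : {y : P // p y = v}) :
    h.sheet v q = y ↔ 0 < q.1.1.2 y := by
  constructor
  · rintro rfl
    rw [h.starLift_sheet v q]
    simp [starLift, h.refl, (h.sheet v q).2, q.2]
  · intro hy
    exact Subtype.ext ((h.existsUnique_pos q.1 q.2).choose_spec.2.2 y y.2 hy).symm

lemma IsCombCover.isCoveringMap (h : IsCombCover X p N) : IsCoveringMap (totalProj X p N) := by
  intro f
  obtain ⟨v, hv⟩ := exists_pos_of_mem_realization f.2
  let _ : TopologicalSpace {y : P // p y = v} := ⊥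
  have : DiscreteTopology {y : P // p y = v} := ⟨rfl⟩
  have hU : IsOpen {f : X.realization | 0 < f.1 v} :=
    isOpen_lt continuous_const ((continuous_apply v).comp continuous_subtype_val)
  have hev : IsEvenlyCovered (totalProj X p N) f {y : P // p y = v} := by
    refine ⟨inferInstance, {f | 0 < f.1 v}, hv, hU, hU.preimage continuous_totalProj, ?_⟩
    have mem : ∀ (f : X.realization), 0 < f.1 v → ∀ y : {y : P // p y = v},
        (f.1, starLift p N y f.1) ∈ totalSpace X p N := fun f hf y =>
      ⟨f.2, y, by rw [y.2]; exact hf, rfl⟩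
    refine ⟨{ toFun := fun q => (⟨totalProj X p N q, q.2⟩, h.sheet v ⟨q.1, q.2⟩)
              invFun := fun r => ⟨⟨(r.1.1.1, starLift p N r.2 r.1.1.1), mem r.1.1 r.1.2 r.2⟩, r.1.2⟩
              left_inv := ?_
              right_inv := ?_
              continuous_toFun := ?_
              continuous_invFun := ?_ }, fun _ => rfl⟩
    · rintro ⟨q, hq⟩
      exact Subtype.ext (Subtype.ext (Prod.ext rfl (h.starLift_sheet v ⟨q, hq⟩).symm))
    · rintro ⟨⟨f, hf⟩, y⟩
      refine Prod.ext rfl ((h.sheet_eq_iff v _ y).2 ?_)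
      simpa [starLift, h.refl, y.2] using hf
    · refine Continuous.prodMk ?_ ?_
      · exact (continuous_totalProj.comp continuous_subtype_val).subtype_mk _
      · refine continuous_discrete_rng.2 fun y => ?_
        have : (fun q : totalProj X p N ⁻¹' {f | 0 < f.1 v} => h.sheet v ⟨q.1, q.2⟩) ⁻¹' {y} =
            {q | 0 < q.1.1.2 y} := by
          ext q
          exact h.sheet_eq_iff v ⟨q.1, q.2⟩ y
        rw [this]
        exact isOpen_lt continuous_const (by fun_prop)
    · refine Continuous.subtype_mk (Continuous.subtype_mk (Continuous.prodMk (by fun_prop) ?_) _) _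
      rw [continuous_iff_continuousAt]
      rintro ⟨f, y⟩
      have hy : ∀ᶠ r : {f : X.realization | 0 < f.1 v} × {y : P // p y = v} in 𝓝 (f, y),
          r.2 = y := by
        have : IsOpen {r : {f : X.realization | 0 < f.1 v} × {y : P // p y = v} | r.2 = y} :=
          (isOpen_discrete {y}).preimage continuous_snd
        exact this.mem_nhds rfl
      have hc : Continuous fun r : {f : X.realization | 0 < f.1 v} × {y : P // p y = v} =>
          starLift p N y r.1.1.1 := (continuous_starLift _).comp (by fun_prop)
      refine hc.continuousAt.congr ?_
      filter_upwards [hy] with r hr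
      rw [hr]
  exact hev.to_isEvenlyCovered_preimage

/-- The vertex `v` as a point of the realization. -/
def vertexPoint (v : V) : V → ℝ := Pi.single v 1

lemma segment_mem_realization {v w : V} (hvw : ({v, w} : Finset V) ∈ X.faces) {t : ℝ}
    (h0 : 0 ≤ t) (h1 : t ≤ 1) :
    (1 - t) • vertexPoint v + t • vertexPoint w ∈ X.realization := by
  refine ⟨fun u => ?_, {v, w}, hvw, fun u hu => ?_, ?_⟩
  · have hv : 0 ≤ vertexPoint v u := by unfold vertexPoint; rw [Pi.single_apply]; split_ifs <;> simp
    have hw : 0 ≤ vertexPoint w u := by unfold vertexPoint; rw [Pi.single_apply]; split_ifs <;> simp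
    have : 0 ≤ 1 - t := by linarith
    simp only [Pi.add_apply, Pi.smul_apply, smul_eq_mul]
    positivity
  · simp only [Finset.mem_insert, Finset.mem_singleton, not_or] at hu
    simp [vertexPoint, hu.1, hu.2]
  · simp [Finset.sum_add_distrib, ← Finset.mul_sum, vertexPoint]

lemma segment_support {v w u : V} (t : ℝ) (hu : u ∉ ({v, w} : Finset V)) :
    ((1 - t) • vertexPoint v + t • vertexPoint w : V → ℝ) u = 0 := by
  simp only [Finset.mem_insert, Finset.mem_singleton, not_or] at hu
  simp [vertexPoint, hu.1, hu.2]

lemma IsCombCover.vertexPoint_mem (h : IsCombCover X p N) (x : P) :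
    (vertexPoint (p x), starLift p N x (vertexPoint (p x))) ∈ totalSpace X p N := by
  refine ⟨?_, x, by simp [vertexPoint], rfl⟩
  simpa using segment_mem_realization (h.edge x x (h.refl x)) le_rfl zero_le_one

/-- The point of the total space corresponding to `x`. -/
noncomputable def IsCombCover.point (h : IsCombCover X p N) (x : P) : totalSpace X p N :=
  ⟨_, h.vertexPoint_mem x⟩

lemma IsCombCover.joined (h : IsCombCover X p N) {x y : P} (hxy : N x y) :
    Joined (h.point x) (h.point y) := by
  have hx : p x ∈ ({p x, p y} : Finset V) := by simp
  have hy : p y ∈ ({p x, p y} : Finset V) := by simp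
  refine ⟨⟨⟨fun t => ⟨((1 - (t : ℝ)) • vertexPoint (p x) + (t : ℝ) • vertexPoint (p y), _),
    h.mk_mem_totalSpace (segment_mem_realization (h.edge x y hxy) t.2.1 t.2.2) (h.edge x y hxy)
      (fun u hu => segment_support _ hu) hx⟩, ?_⟩, ?_, ?_⟩⟩
  · refine Continuous.subtype_mk (Continuous.prodMk ?_ ?_) _
    · fun_prop
    · exact (continuous_starLift _).comp (by fun_prop)
  · refine Subtype.ext ?_
    simp [IsCombCover.point]
  · refine Subtype.ext ?_
    simp only [IsCombCover.point, Set.Icc.coe_one, sub_self, zero_smul, zero_add, one_smul]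
    refine Prod.ext rfl (h.starLift_eq (h.edge x y hxy) (fun u hu => ?_) hxy hx hy)
    simpa using segment_support 1 hu

lemma IsCombCover.eq_of_joined (h : IsCombCover X p N) [SimplyConnectedSpace X.realization]
    {x y : P} (hxy : Joined (h.point x) (h.point y)) (hp : p x = p y) : x = y := by
  obtain ⟨γ⟩ := hxy
  have cov := h.isCoveringMap
  have hpt : totalProj X p N (h.point y) = totalProj X p N (h.point x) :=
    Subtype.ext (congrArg vertexPoint hp.symm)
  let δ : Path (totalProj X p N (h.point x)) (totalProj X p N (h.point x)) :=
    (γ.map cov.continuous).cast rfl hpt.symm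
  have hδ : Path.Homotopic δ (Path.refl _) := SimplyConnectedSpace.paths_homotopic _ _
  have hend := cov.liftPath_apply_one_eq_of_homotopicRel hδ (h.point x) (by simp) (by simp)
  have h1 : γ.toContinuousMap = cov.liftPath δ.toContinuousMap (h.point x) (by simp) :=
    (cov.eq_liftPath_iff' _).2 ⟨by ext; rfl, by simp⟩
  have h2 : ContinuousMap.const _ (h.point x) =
      cov.liftPath (Path.refl (totalProj X p N (h.point x))).toContinuousMap (h.point x)
        (by simp) := (cov.eq_liftPath_iff' _).2 ⟨by ext; rfl, rfl⟩
  rw [← h1, ← h2] at hend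
  have hpts : h.point y = h.point x := by simpa using hend
  have heq := congrFun (congrArg (fun q => q.1.2) hpts) y
  have hN : N x y := by
    by_contra hc
    simp [IsCombCover.point, starLift, h.refl, vertexPoint, hc] at heq
  exact h.lift_unique x x y (h.refl x) hN hp

/-- A connected combinatorial covering of a simply connected complex is injective. -/
theorem IsCombCover.injective_of_connected (h : IsCombCover X p N)
    [SimplyConnectedSpace X.realization] (hconn : ∀ x y, Relation.ReflTransGen N x y) :
    Function.Injective p := by
  intro x y hp
  refine h.eq_of_joined ?_ hp
  clear hp
  induction hconn x y with
  | refl => exact Joined.refl _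
  | tail _ hN ih => exact ih.trans (h.joined hN)

end Covering

end SComplex

namespace SComplex

section LocalConditions

variable {V : Type*} [DecidableEq V] {X : SComplex V} {a b c d e v : V}

/-- The vertices `a`, `b`, `c` (possibly with repetitions) span a simplex. -/
def Tri (X : SComplex V) (a b c : V) : Prop := ({a, b, c} : Finset V) ∈ X.faces

lemma Tri.rot (h : X.Tri a b c) : X.Tri b c a :=
  faces_mono h (by simp [Finset.insert_subset_iff]) (by simp)

lemma Tri.swap (h : X.Tri a b c) : X.Tri b a c :=
  faces_mono h (by simp [Finset.insert_subset_iff]) (by simp)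

lemma Tri.edge (h : X.Tri a b c) : ({a, b} : Finset V) ∈ X.faces :=
  faces_mono h (by simp [Finset.insert_subset_iff]) (by simp)

lemma tri_of_edge (h : ({a, b} : Finset V) ∈ X.faces) : X.Tri a b b := by
  simpa [Tri] using h

lemma tri_of_mem {σ : Finset V} (hσ : σ ∈ X.faces) (ha : a ∈ σ) (hb : b ∈ σ) (hc : c ∈ σ) :
    X.Tri a b c :=
  faces_mono hσ (by simp [Finset.insert_subset_iff, ha, hb, hc]) (by simp)

lemma edge_of_mem {σ : Finset V} (hσ : σ ∈ X.faces) (ha : a ∈ σ) (hb : b ∈ σ) :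
    ({a, b} : Finset V) ∈ X.faces := (tri_of_mem hσ ha hb hb).edge

lemma edge_mem_link (ha : a ≠ v) (hb : b ≠ v) :
    ({a, b} : Finset V) ∈ (X.link {v}).faces ↔ X.Tri v a b := by
  constructor
  · intro h
    exact tri_of_mem h.2.2 (by simp) (by simp) (by simp)
  · intro h
    refine ⟨h.rot.edge, by simp [ha.symm, hb.symm], faces_mono h ?_ (by simp)⟩
    simp [Finset.insert_subset_iff]

lemma LocallyKLarge.mem_faces_of_tri {k : ℕ} (hX : LocallyKLarge k X) {A : Finset V} (hv : v ∈ A)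
    (h : ∀ a ∈ A, ∀ b ∈ A, X.Tri v a b) : A ∈ X.faces := by
  have hvv : ({v} : Finset V) ∈ X.faces := by simpa [Tri] using h v hv v hv
  rcases (A.erase v).eq_empty_or_nonempty with he | hne
  · rwa [← Finset.insert_erase hv, he]
  · have := ((hX {v} hvv).1 (A.erase v) hne ?_ ?_).2.2
    · rwa [Finset.union_comm, ← Finset.insert_eq, Finset.insert_erase hv] at this
    · intro a ha
      rw [Finset.mem_erase] at ha
      simpa using (edge_mem_link ha.1 ha.1).2 (h a ha.2 a ha.2)
    · intro a ha b hb _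
      rw [Finset.mem_erase] at ha hb
      exact (edge_mem_link ha.1 hb.1).2 (h a ha.2 b hb.2)

lemma LocallyKLarge.tri_of_link {k : ℕ} (hX : LocallyKLarge k X) (hab : X.Tri v a b)
    (hbc : X.Tri v b c) (hac : X.Tri v a c) : X.Tri a b c := by
  have : ({v, a, b, c} : Finset V) ∈ X.faces := by
    refine hX.mem_faces_of_tri (v := v) (by simp) ?_
    have hv : X.Tri v v v := by simpa [Tri] using tri_of_mem hab (a := v) (b := v) (c := v)
    have ha : X.Tri v a a := tri_of_mem hab (by simp) (by simp) (by simp)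
    have hb : X.Tri v b b := tri_of_mem hab (by simp) (by simp) (by simp)
    have hc : X.Tri v c c := tri_of_mem hac (by simp) (by simp) (by simp)
    have hvx : ∀ x, X.Tri v x x → X.Tri v v x := fun x h => tri_of_mem h (by simp) (by simp) (by simp)
    have hxv : ∀ x, X.Tri v x x → X.Tri v x v := fun x h => tri_of_mem h (by simp) (by simp) (by simp)
    have := hab.swap.rot
    have := hbc.swap.rot
    have := hac.swap.rot
    simp only [Finset.mem_insert, Finset.mem_singleton]
    rintro x (rfl | rfl | rfl | rfl) y (rfl | rfl | rfl | rfl) <;> simp_all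
  exact tri_of_mem this (by simp) (by simp) (by simp)

lemma LocallyKLarge.four_cycle (hX : LocallyKLarge 6 X) (hab : X.Tri v a b) (hbc : X.Tri v b c)
    (hcd : X.Tri v c d) (hda : X.Tri v d a) : X.Tri v a c ∨ X.Tri v b d := by
  by_contra! hcon
  obtain ⟨hac, hbd⟩ := hcon
  have hvv : ({v} : Finset V) ∈ X.faces := faces_mono hab (by simp) (by simp)
  have ne_ab : a ≠ b := by rintro rfl; exact hac hbc
  have ne_bc : b ≠ c := by rintro rfl; exact hac hab
  have ne_cd : c ≠ d := by rintro rfl; exact hbd hbc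
  have ne_da : d ≠ a := by rintro rfl; exact hac hcd.swap.rot
  have ne_ac : a ≠ c := by rintro rfl; exact hac (tri_of_mem hab (by simp) (by simp) (by simp))
  have ne_bd : b ≠ d := by rintro rfl; exact hbd (tri_of_mem hab (by simp) (by simp) (by simp))
  have ne_a : a ≠ v := by rintro rfl; exact hac (tri_of_mem hbc (by simp) (by simp) (by simp))
  have ne_b : b ≠ v := by rintro rfl; exact hbd (tri_of_mem hcd (by simp) (by simp) (by simp))
  have ne_c : c ≠ v := by rintro rfl; exact hac (tri_of_mem hab (by simp) (by simp) (by simp))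
  have ne_d : d ≠ v := by rintro rfl; exact hbd (tri_of_mem hbc (by simp) (by simp) (by simp))
  let γ : ZMod 4 → V := (![a, b, c, d] : Fin 4 → V)
  have hγ : (X.link {v}).IsCycle 4 γ := by
    refine ⟨by norm_num, ?_, ?_⟩
    · have : Function.Injective (![a, b, c, d] : Fin 4 → V) := by
        intro i j hij
        fin_cases i <;> fin_cases j <;> simp_all
      exact this
    · intro i
      change Fin 4 at i
      fin_cases i
      · exact (edge_mem_link ne_a ne_b).2 hab
      · exact (edge_mem_link ne_b ne_c).2 hbc
      · exact (edge_mem_link ne_c ne_d).2 hcd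
      · exact (edge_mem_link ne_d ne_a).2 hda
  obtain ⟨i, j, h1, h2, h3, hij⟩ := (hX {v} hvv).2 4 γ hγ le_rfl (by norm_num)
  have hac' := fun h => hac ((edge_mem_link ne_a ne_c).1 h)
  have hbd' := fun h => hbd ((edge_mem_link ne_b ne_d).1 h)
  have hca' := fun h => hac ((edge_mem_link ne_c ne_a).1 h).swap.rot
  have hdb' := fun h => hbd ((edge_mem_link ne_d ne_b).1 h).swap.rot
  change Fin 4 at i j
  fin_cases i <;> fin_cases j <;>
    first
    | exact h1 rfl
    | exact h2 rfl
    | exact h3 rfl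
    | exact hac' hij
    | exact hbd' hij
    | exact hca' hij
    | exact hdb' hij

lemma LocallyKLarge.five_cycle (hX : LocallyKLarge 6 X) (hab : X.Tri v a b) (hbc : X.Tri v b c)
    (hcd : X.Tri v c d) (hde : X.Tri v d e) (hea : X.Tri v e a) :
    X.Tri v a c ∨ X.Tri v b d ∨ X.Tri v c e ∨ X.Tri v d a ∨ X.Tri v e b := by
  by_contra! hcon
  obtain ⟨hac, hbd, hce, hda, heb⟩ := hcon
  have hvv : ({v} : Finset V) ∈ X.faces := faces_mono hab (by simp) (by simp)
  have ne_ab : a ≠ b := by rintro rfl; exact hac hbc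
  have ne_bc : b ≠ c := by rintro rfl; exact hac hab
  have ne_cd : c ≠ d := by rintro rfl; exact hbd hbc
  have ne_de : d ≠ e := by rintro rfl; exact hce hcd
  have ne_ea : e ≠ a := by rintro rfl; exact hda hde
  have ne_ac : a ≠ c := by rintro rfl; exact hac (tri_of_mem hab (by simp) (by simp) (by simp))
  have ne_bd : b ≠ d := by rintro rfl; exact hbd (tri_of_mem hab (by simp) (by simp) (by simp))
  have ne_ce : c ≠ e := by rintro rfl; exact hce (tri_of_mem hcd (by simp) (by simp) (by simp))
  have ne_da : d ≠ a := by rintro rfl; exact hda (tri_of_mem hde (by simp) (by simp) (by simp))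
  have ne_eb : e ≠ b := by rintro rfl; exact heb (tri_of_mem hab (by simp) (by simp) (by simp))
  have ne_a : a ≠ v := by rintro rfl; exact hac (tri_of_mem hbc (by simp) (by simp) (by simp))
  have ne_b : b ≠ v := by rintro rfl; exact hbd (tri_of_mem hcd (by simp) (by simp) (by simp))
  have ne_c : c ≠ v := by rintro rfl; exact hac (tri_of_mem hab (by simp) (by simp) (by simp))
  have ne_d : d ≠ v := by rintro rfl; exact hbd (tri_of_mem hbc (by simp) (by simp) (by simp))
  have ne_e : e ≠ v := by rintro rfl; exact hce (tri_of_mem hcd (by simp) (by simp) (by simp))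
  let γ : ZMod 5 → V := (![a, b, c, d, e] : Fin 5 → V)
  have hγ : (X.link {v}).IsCycle 5 γ := by
    refine ⟨by norm_num, ?_, ?_⟩
    · have : Function.Injective (![a, b, c, d, e] : Fin 5 → V) := by
        intro i j hij
        fin_cases i <;> fin_cases j <;> simp_all
      exact this
    · intro i
      change Fin 5 at i
      fin_cases i
      · exact (edge_mem_link ne_a ne_b).2 hab
      · exact (edge_mem_link ne_b ne_c).2 hbc
      · exact (edge_mem_link ne_c ne_d).2 hcd
      · exact (edge_mem_link ne_d ne_e).2 hde
      · exact (edge_mem_link ne_e ne_a).2 hea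
  obtain ⟨i, j, h1, h2, h3, hij⟩ := (hX {v} hvv).2 5 γ hγ (by norm_num) (by norm_num)
  have hac₁ := fun h => hac ((edge_mem_link ne_a ne_c).1 h)
  have hbd₁ := fun h => hbd ((edge_mem_link ne_b ne_d).1 h)
  have hce₁ := fun h => hce ((edge_mem_link ne_c ne_e).1 h)
  have hda₁ := fun h => hda ((edge_mem_link ne_d ne_a).1 h)
  have heb₁ := fun h => heb ((edge_mem_link ne_e ne_b).1 h)
  have hac₂ := fun h => hac ((edge_mem_link ne_c ne_a).1 h).swap.rot
  have hbd₂ := fun h => hbd ((edge_mem_link ne_d ne_b).1 h).swap.rot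
  have hce₂ := fun h => hce ((edge_mem_link ne_e ne_c).1 h).swap.rot
  have hda₂ := fun h => hda ((edge_mem_link ne_a ne_d).1 h).swap.rot
  have heb₂ := fun h => heb ((edge_mem_link ne_b ne_e).1 h).swap.rot
  change Fin 5 at i j
  fin_cases i <;> fin_cases j <;>
    first
    | exact h1 rfl
    | exact h2 rfl
    | exact h3 rfl
    | exact hac₁ hij
    | exact hbd₁ hij
    | exact hce₁ hij
    | exact hda₁ hij
    | exact heb₁ hij
    | exact hac₂ hij
    | exact hbd₂ hij
    | exact hce₂ hij
    | exact hda₂ hij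
    | exact heb₂ hij

end LocalConditions

end SComplex

namespace SComplex

section Stages

variable {V : Type u} [DecidableEq V]

/-- Two consecutive levels of a combinatorial covering of `X` which is built outwards from a
simplex: `Cur` is the outermost level constructed so far, with labels `p` and horizontal
neighbour relation `R`, and `D` relates the level `Prev` (with labels `q`) to `Cur`. -/
structure Stage (X : SComplex V) where
  Prev : Type u
  Cur : Type u
  q : Prev → V
  p : Cur → V
  R : Cur → Cur → Prop
  D : Prev → Cur → Prop
  refl : ∀ x, R x x
  symm : ∀ {x y}, R x y → R y x
  edge : ∀ {x y}, R x y → ({p x, p y} : Finset V) ∈ X.faces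
  edge_D : ∀ {u x}, D u x → ({q u, p x} : Finset V) ∈ X.faces
  R_unique : ∀ {x y z}, R x y → R x z → p y = p z → y = z
  D_unique_left : ∀ {u u' x}, D u x → D u' x → q u = q u' → u = u'
  D_unique_right : ∀ {u x x'}, D u x → D u x' → p x = p x' → x = x'
  RD_ne : ∀ {u x y}, R x y → D u x → p y ≠ q u
  tri_RR : ∀ {x y z}, R x y → R x z → X.Tri (p x) (p y) (p z) → R y z
  tri_RD : ∀ {u x y}, R x y → D u x → X.Tri (p x) (p y) (q u) → D u y
  tri_DD : ∀ {u u' x}, D u x → D u' x → X.Tri (p x) (q u) (q u')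
  edge_cond : (∀ x y z, R x y ∧ X.Tri (p x) (p y) (p z)) ∨
    ∀ x y, R x y → ∃ u, D u x ∧ D u y ∧ X.Tri (q u) (p x) (p y)
  lift_D : ∀ {u x z}, D u x → X.Tri (q u) (p x) z →
    (∃ t, R x t ∧ p t = z) ∨ ∃ t, D t x ∧ q t = z

namespace Stage

variable {X : SComplex V}

/-- The innermost stage: the level `0` is the simplex `τ`. -/
def base (τ : Finset V) (hτ : τ ∈ X.faces) : Stage X where
  Prev := PEmpty
  Cur := {v // v ∈ τ}
  q := PEmpty.elim
  p := Subtype.val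
  R := fun _ _ => True
  D := fun _ _ => False
  refl := fun _ => trivial
  symm := fun _ => trivial
  edge := fun {x y} _ => edge_of_mem hτ x.2 y.2
  edge_D := False.elim
  R_unique := fun _ _ h => Subtype.ext h
  D_unique_left := False.elim
  D_unique_right := False.elim
  RD_ne := fun _ h => h.elim
  tri_RR := fun _ _ _ => trivial
  tri_RD := fun _ h _ => h
  tri_DD := False.elim
  edge_cond := Or.inl fun x y z => ⟨trivial, tri_of_mem hτ x.2 y.2 z.2⟩
  lift_D := False.elim

variable (s : Stage X)

/-- The edge from `p w` to `z` does not yet lift to the stage `s` at `w`. -/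
def IsNew (w : s.Cur) (z : V) : Prop :=
  ({s.p w, z} : Finset V) ∈ X.faces ∧ (∀ t, s.R w t → s.p t ≠ z) ∧ ∀ u, s.D u w → s.q u ≠ z

variable {s} {a b c w w' : s.Cur} {z : V}

lemma IsNew.not_tri {u : s.Prev} (h : s.IsNew w z) (hu : s.D u w) :
    ¬ X.Tri (s.q u) (s.p w) z := by
  intro ht
  rcases s.lift_D hu ht with ⟨t, hR, rfl⟩ | ⟨t, hD, rfl⟩
  · exact h.2.1 t hR rfl
  · exact h.2.2 t hD rfl

lemma IsNew.move (h : s.IsNew w z) (hR : s.R w w') (ht : X.Tri z (s.p w) (s.p w')) :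
    s.IsNew w' z := by
  refine ⟨ht.rot.rot.edge, ?_, ?_⟩
  · rintro t hwt rfl
    exact h.2.1 t (s.tri_RR (s.symm hR) hwt ht.rot.swap) rfl
  · rintro u hu rfl
    exact h.2.2 u (s.tri_RD (s.symm hR) hu ht.rot.swap) rfl

lemma IsNew.trans (hX : LocallyKLarge 6 X) (h : s.IsNew b z) (hba : s.R b a) (hbc : s.R b c)
    (hza : X.Tri z (s.p b) (s.p a)) (hzc : X.Tri z (s.p b) (s.p c)) :
    s.R a c ∧ X.Tri z (s.p a) (s.p c) := by
  have key : X.Tri (s.p b) (s.p a) (s.p c) := by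
    rcases s.edge_cond with h0 | h1
    · exact (h0 b a c).2
    · obtain ⟨u, hub, hua, htu⟩ := h1 b a hba
      obtain ⟨u', hub', huc', htu'⟩ := h1 b c hbc
      have hz : ∀ {u}, s.D u b → ¬ X.Tri (s.p b) z (s.q u) := fun hu ht =>
        h.not_tri hu ht.rot.rot
      rcases hX.five_cycle hza.swap htu.rot (s.tri_DD hub hub') htu'.swap hzc.rot with
        h | h | h | h | h
      · exact (hz hub h).elim
      · rcases hX.four_cycle hza.swap h htu'.swap hzc.rot with h | h
        · exact (hz hub' h).elim
        · exact h
      · rcases hX.four_cycle hza.swap htu.rot h hzc.rot with h | h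
        · exact (hz hub h).elim
        · exact h
      · exact (hz hub' h.swap.rot).elim
      · exact h.swap.rot
  exact ⟨s.tri_RR hba hbc key, hX.tri_of_link hza.swap key hzc.swap⟩

variable (s)

/-- Two unlifted edges with the same endpoint are identified if they span a triangle with a
horizontal edge of `s`. -/
def newSetoid (hX : LocallyKLarge 6 X) : Setoid {a : s.Cur × V // s.IsNew a.1 a.2} where
  r a b := a.1.2 = b.1.2 ∧ s.R a.1.1 b.1.1 ∧ X.Tri a.1.2 (s.p a.1.1) (s.p b.1.1)
  iseqv := by
    refine ⟨?_, ?_, ?_⟩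
    · rintro ⟨⟨a, z⟩, h⟩
      exact ⟨rfl, s.refl a, tri_of_mem h.1 (by simp) (by simp) (by simp)⟩
    · rintro ⟨⟨a, z⟩, h⟩ ⟨⟨b, z'⟩, h'⟩ ⟨rfl, hR, ht⟩
      exact ⟨rfl, s.symm hR, ht.swap.rot⟩
    · rintro ⟨⟨a, z⟩, h⟩ ⟨⟨b, z'⟩, h'⟩ ⟨⟨c, z''⟩, h''⟩ ⟨rfl, hR, ht⟩ ⟨rfl, hR', ht'⟩
      exact ⟨rfl, IsNew.trans hX h' (s.symm hR) hR' ht.swap.rot ht'⟩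

/-- The vertices of the next level. -/
def Next (hX : LocallyKLarge 6 X) : Type u := Quotient (s.newSetoid hX)

variable {s} (hX : LocallyKLarge 6 X)

/-- The label of a vertex of the next level. -/
def nextLabel : s.Next hX → V := Quotient.lift (fun a => a.1.2) fun _ _ h => h.1

/-- The endpoint in the next level of the lift of an unlifted edge. -/
def IsNew.endpoint (h : s.IsNew w z) : s.Next hX := Quotient.mk _ ⟨(w, z), h⟩

/-- The vertical relation of the next stage. -/
def NextD (w : s.Cur) (x : s.Next hX) : Prop :=
  ∃ z, ∃ h : s.IsNew w z, h.endpoint hX = x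

/-- The horizontal relation of the next stage. -/
def NextR (x y : s.Next hX) : Prop :=
  ∃ w, NextD hX w x ∧ NextD hX w y ∧ X.Tri (s.p w) (nextLabel hX x) (nextLabel hX y)

variable {hX} {x y y' : s.Next hX}

lemma exists_nextD (x : s.Next hX) : ∃ w, NextD hX w x := by
  obtain ⟨⟨⟨w, z⟩, h⟩, rfl⟩ := Quotient.exists_rep x
  exact ⟨w, z, h, rfl⟩

lemma NextD.isNew (h : NextD hX w x) : s.IsNew w (nextLabel hX x) := by
  obtain ⟨z, h, rfl⟩ := h
  exact h

lemma NextD.unique_right (h : NextD hX w x) (h' : NextD hX w y)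
    (hp : nextLabel hX x = nextLabel hX y) : x = y := by
  obtain ⟨z, h, rfl⟩ := h
  obtain ⟨z', h', rfl⟩ := h'
  obtain rfl : z = z' := hp
  rfl

lemma NextD.rel (h : NextD hX w x) (h' : NextD hX w' x) :
    s.R w w' ∧ X.Tri (nextLabel hX x) (s.p w) (s.p w') := by
  obtain ⟨z, h, rfl⟩ := h
  obtain ⟨z', h', he⟩ := h'
  exact (Quotient.exact he.symm).2

lemma NextD.move (h : NextD hX w x) (hR : s.R w w')
    (ht : X.Tri (nextLabel hX x) (s.p w) (s.p w')) : NextD hX w' x := by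
  obtain ⟨z, h, rfl⟩ := h
  exact ⟨z, h.move hR ht, (Quotient.sound (s := s.newSetoid hX) (a := ⟨(w, z), h⟩)
    (b := ⟨(w', z), h.move hR ht⟩) ⟨rfl, hR, ht⟩).symm⟩

lemma NextR.tri_nextD (h : NextR hX x y) (hu : NextD hX w x)
    (ht : X.Tri (nextLabel hX x) (nextLabel hX y) (s.p w)) : NextD hX w y := by
  obtain ⟨w', hx, hy, h'⟩ := h
  have hrel := hx.rel hu
  exact hy.move hrel.1 (hX.tri_of_link h'.rot hrel.2 ht)

lemma NextR.symm (h : NextR hX x y) : NextR hX y x := by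
  obtain ⟨w, hx, hy, h⟩ := h
  exact ⟨w, hy, hx, h.swap.rot⟩

lemma NextR.unique (h : NextR hX x y) (h' : NextR hX x y')
    (hp : nextLabel hX y = nextLabel hX y') : y = y' := by
  obtain ⟨w, hx, hy, ht⟩ := h
  obtain ⟨w', hx', hy', ht'⟩ := h'
  have hrel := hx.rel hx'
  refine (hy.move hrel.1 (hX.tri_of_link ht.rot hrel.2 ?_)).unique_right hy' hp
  rw [hp]
  exact ht'.rot

lemma NextR.tri (h : NextR hX x y) (h' : NextR hX x y')
    (ht : X.Tri (nextLabel hX x) (nextLabel hX y) (nextLabel hX y')) : NextR hX y y' := by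
  obtain ⟨w, hx, hy, hw⟩ := id h
  obtain ⟨w', hx', hy', hw'⟩ := id h'
  rcases hX.four_cycle ht hw'.rot (hx'.rel hx).2 hw.swap with hd | hd
  · exact ⟨w', h.tri_nextD hx' hd, hy', hX.tri_of_link hd.swap.rot ht hw'.swap⟩
  · exact ⟨w, hy, h'.tri_nextD hx hd, hX.tri_of_link hw.swap ht hd.swap.rot⟩

lemma NextD.lift (h : NextD hX w x) (ht : X.Tri (s.p w) (nextLabel hX x) z) :
    (∃ t, NextR hX x t ∧ nextLabel hX t = z) ∨ ∃ t, NextD hX t x ∧ s.p t = z := by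
  by_cases hz : s.IsNew w z
  · exact Or.inl ⟨hz.endpoint hX, ⟨w, h, ⟨z, hz, rfl⟩, ht⟩, rfl⟩
  · right
    have : ¬ ((∀ t, s.R w t → s.p t ≠ z) ∧ ∀ u, s.D u w → s.q u ≠ z) := fun hc =>
      hz ⟨ht.swap.rot.edge, hc⟩
    rw [not_and_or] at this
    push Not at this
    rcases this with ⟨t, ht', rfl⟩ | ⟨u, hu, rfl⟩
    · exact ⟨t, h.move ht' ht.swap, rfl⟩
    · exact (h.isNew.not_tri hu ht.rot.rot).elim

variable (s hX) in
/-- The stage following `s`. -/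
def next : Stage X where
  Prev := s.Cur
  Cur := s.Next hX
  q := s.p
  p := nextLabel hX
  R := NextR hX
  D := NextD hX
  refl := fun x => by
    obtain ⟨w, hw⟩ := exists_nextD x
    exact ⟨w, hw, hw, tri_of_edge hw.isNew.1⟩
  symm := NextR.symm
  edge := by
    rintro x y ⟨w, -, -, h⟩
    exact h.rot.edge
  edge_D := fun h => h.isNew.1
  R_unique := NextR.unique
  D_unique_left := fun h h' hp => s.R_unique (s.refl _) (h.rel h').1 hp
  D_unique_right := NextD.unique_right
  RD_ne := by
    rintro u x y ⟨w, hx, hy, -⟩ hu hp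
    exact hy.isNew.2.1 u (hx.rel hu).1 hp.symm
  tri_RR := NextR.tri
  tri_RD := NextR.tri_nextD
  tri_DD := fun h h' => (h.rel h').2
  edge_cond := Or.inr fun _ _ h => h
  lift_D := NextD.lift

end Stage

end Stages

end SComplex

namespace SComplex

section Tower

variable {V : Type u} [DecidableEq V] {X : SComplex V} (hX : LocallyKLarge 6 X) {τ : Finset V}
  (hτ : τ ∈ X.faces)

open Stage

/-- The stages of the combinatorial covering built outwards from `τ`. -/
def stage : ℕ → Stage X
  | 0 => Stage.base τ hτ
  | k + 1 => (stage k).next hX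

/-- The vertex set of the combinatorial covering built outwards from `τ`. -/
def Tower : Type u := Σ k, (stage hX hτ k).Cur

/-- The label of a vertex of the covering. -/
def towerLabel (x : Tower hX hτ) : V := (stage hX hτ x.1).p x.2

/-- The neighbour relation of the covering. -/
inductive TowerNbr : Tower hX hτ → Tower hX hτ → Prop
  | same {k : ℕ} {x y : (stage hX hτ k).Cur} (h : (stage hX hτ k).R x y) : TowerNbr ⟨k, x⟩ ⟨k, y⟩
  | up {k : ℕ} {x : (stage hX hτ k).Cur} {y : (stage hX hτ (k + 1)).Cur}
      (h : NextD hX x y) : TowerNbr ⟨k, x⟩ ⟨k + 1, y⟩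
  | down {k : ℕ} {x : (stage hX hτ k).Cur} {y : (stage hX hτ (k + 1)).Cur}
      (h : NextD hX x y) : TowerNbr ⟨k + 1, y⟩ ⟨k, x⟩

variable {hX hτ}

lemma TowerNbr.symm {x y : Tower hX hτ} (h : TowerNbr hX hτ x y) : TowerNbr hX hτ y x := by
  cases h with
  | same h => exact .same (Stage.symm _ h)
  | up h => exact .down h
  | down h => exact .up h

lemma TowerNbr.exists_lift (x : Tower hX hτ) {b : V}
    (hb : ({towerLabel hX hτ x, b} : Finset V) ∈ X.faces) :
    ∃ y, TowerNbr hX hτ x y ∧ towerLabel hX hτ y = b := by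
  obtain ⟨k, x⟩ := x
  by_cases hnew : (stage hX hτ k).IsNew x b
  · exact ⟨⟨k + 1, hnew.endpoint hX⟩, .up ⟨b, hnew, rfl⟩, rfl⟩
  · have : ¬ ((∀ t, (stage hX hτ k).R x t → (stage hX hτ k).p t ≠ b) ∧
        ∀ u, (stage hX hτ k).D u x → (stage hX hτ k).q u ≠ b) := fun hc => hnew ⟨hb, hc⟩
    rw [not_and_or] at this
    push Not at this
    rcases this with ⟨t, ht, hp⟩ | ⟨u, hu, hq⟩
    · exact ⟨⟨k, t⟩, .same ht, hp⟩
    · cases k with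
      | zero => exact hu.elim
      | succ k => exact ⟨⟨k, u⟩, .down hu, hq⟩

lemma TowerNbr.lift_unique {x y z : Tower hX hτ} (hy : TowerNbr hX hτ x y)
    (hz : TowerNbr hX hτ x z) (hp : towerLabel hX hτ y = towerLabel hX hτ z) : y = z := by
  cases hy with
  | same hy =>
    cases hz with
    | same hz => exact congrArg _ (Stage.R_unique _ hy hz hp)
    | up hz => exact (hz.isNew.2.1 _ hy hp).elim
    | down hz => exact (Stage.RD_ne _ hy hz hp).elim
  | up hy =>
    cases hz with
    | same hz => exact (hy.isNew.2.1 _ hz hp.symm).elim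
    | up hz => exact congrArg _ (hy.unique_right hz hp)
    | down hz => exact (hy.isNew.2.2 _ hz hp.symm).elim
  | down hy =>
    cases hz with
    | same hz => exact (Stage.RD_ne _ hz hy hp.symm).elim
    | up hz => exact (hz.isNew.2.2 _ hy hp).elim
    | down hz => exact congrArg _ (Stage.D_unique_left ((stage hX hτ _).next hX) hy hz hp)

lemma TowerNbr.triangle {x y z : Tower hX hτ} (hy : TowerNbr hX hτ x y)
    (hz : TowerNbr hX hτ x z)
    (ht : X.Tri (towerLabel hX hτ x) (towerLabel hX hτ y) (towerLabel hX hτ z)) :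
    TowerNbr hX hτ y z := by
  cases hy with
  | same hy =>
    cases hz with
    | same hz => exact .same (Stage.tri_RR _ hy hz ht)
    | up hz => exact .up (hz.move hy ht.rot.rot)
    | down hz => exact .down (Stage.tri_RD _ hy hz ht)
  | up hy =>
    cases hz with
    | same hz => exact .down (hy.move hz ht.swap)
    | up hz => exact .same ⟨_, hy, hz, ht⟩
    | down hz => exact (hy.isNew.not_tri hz ht.rot.rot).elim
  | down hy =>
    cases hz with
    | same hz => exact .up (Stage.tri_RD _ hz hy ht.swap.rot)
    | up hz => exact (hz.isNew.not_tri hy ht.swap).elim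
    | down hz => exact .same (hy.rel hz).1

lemma isCombCover_tower : IsCombCover X (towerLabel hX hτ) (TowerNbr hX hτ) where
  refl x := .same (Stage.refl _ _)
  symm _ _ := TowerNbr.symm
  edge x y h := by
    cases h with
    | same h => exact Stage.edge _ h
    | up h => exact h.isNew.1
    | down h =>
      rw [Finset.pair_comm]
      exact h.isNew.1
  exists_lift x _ := TowerNbr.exists_lift x
  lift_unique _ _ _ := TowerNbr.lift_unique
  triangle _ _ _ := TowerNbr.triangle

lemma tower_connected (x y : Tower hX hτ) : Relation.ReflTransGen (TowerNbr hX hτ) x y := by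
  have key : ∀ k (x : (stage hX hτ k).Cur), ∃ r : (stage hX hτ 0).Cur,
      Relation.ReflTransGen (TowerNbr hX hτ) ⟨k, x⟩ ⟨0, r⟩ ∧
        Relation.ReflTransGen (TowerNbr hX hτ) ⟨0, r⟩ ⟨k, x⟩ := by
    intro k
    induction k with
    | zero => exact fun x => ⟨x, .refl, .refl⟩
    | succ k ih =>
      intro x
      obtain ⟨w, hw⟩ := exists_nextD x
      obtain ⟨r, hr, hr'⟩ := ih w
      exact ⟨r, .head (.down hw) hr, .tail hr' (.up hw)⟩
  obtain ⟨k, x⟩ := x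
  obtain ⟨l, y⟩ := y
  obtain ⟨r, hr, -⟩ := key k x
  obtain ⟨r', -, hr'⟩ := key l y
  have hrr : TowerNbr hX hτ ⟨0, r⟩ ⟨0, r'⟩ := .same trivial
  exact hr.trans (.head hrr hr')

end Tower

section Levels

open Stage

variable {V : Type u} [DecidableEq V] {X : SComplex V} {τ : Finset V} {L : ℕ → V → Prop}

/-- `L` is the decomposition of the vertices of `X` into combinatorial spheres around `τ`, and
balls are convex in the sense that the predecessors of a vertex span a simplex and the endpoints
of a horizontal edge have a common predecessor. -/
structure IsLevelling (X : SComplex V) (τ : Finset V) (L : ℕ → V → Prop) : Prop where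
  zero_iff : ∀ {v}, L 0 v ↔ v ∈ τ
  unique : ∀ {k l v}, L k v → L l v → k = l
  exists_of_edge : ∀ {k v w}, L k v → ({v, w} : Finset V) ∈ X.faces →
    ∃ l, L l w ∧ l ≤ k + 1 ∧ k ≤ l + 1
  exists_pred : ∀ {k v}, L (k + 1) v → ∃ u, L k u ∧ ({u, v} : Finset V) ∈ X.faces
  tri_of_preds : ∀ {k v u u'}, L (k + 1) v → L k u → L k u' → ({v, u} : Finset V) ∈ X.faces →
    ({v, u'} : Finset V) ∈ X.faces → X.Tri v u u'
  exists_common_pred : ∀ {k v w}, L (k + 1) v → L (k + 1) w → ({v, w} : Finset V) ∈ X.faces →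
    ∃ u, L k u ∧ X.Tri u v w

lemma exists_isLevelling (hX : LocallyKLarge 6 X) [SimplyConnectedSpace X.realization]
    (hτ : τ ∈ X.faces) : ∃ L, IsLevelling X τ L := by
  have hcov := isCombCover_tower (hX := hX) (hτ := hτ)
  have hinj := hcov.injective_of_connected tower_connected
  have hnbr : ∀ {k l} {x : (stage hX hτ k).Cur} {y : (stage hX hτ l).Cur},
      ({(stage hX hτ k).p x, (stage hX hτ l).p y} : Finset V) ∈ X.faces →
      TowerNbr hX hτ ⟨k, x⟩ ⟨l, y⟩ := by
    intro k l x y h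
    obtain ⟨z, hz, hp⟩ := TowerNbr.exists_lift ⟨k, x⟩ h
    obtain rfl := hinj (a₁ := z) (a₂ := ⟨l, y⟩) hp
    exact hz
  refine ⟨fun k v => ∃ x, (stage hX hτ k).p x = v, ?_, ?_, ?_, ?_, ?_, ?_⟩
  · intro v
    exact ⟨fun ⟨x, hx⟩ => hx ▸ x.2, fun h => ⟨⟨v, h⟩, rfl⟩⟩
  · rintro k l v ⟨x, hx⟩ ⟨y, hy⟩
    exact congrArg Sigma.fst (hinj (a₁ := ⟨k, x⟩) (a₂ := ⟨l, y⟩) (hx.trans hy.symm))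
  · rintro k v w ⟨x, rfl⟩ h
    obtain ⟨⟨l, y⟩, hy, rfl⟩ := TowerNbr.exists_lift ⟨k, x⟩ h
    refine ⟨l, ⟨y, rfl⟩, ?_⟩
    cases hy <;> omega
  · rintro k v ⟨x, rfl⟩
    obtain ⟨w, hw⟩ := exists_nextD x
    exact ⟨_, ⟨w, rfl⟩, hw.isNew.1⟩
  · rintro k v u u' ⟨x, rfl⟩ ⟨y, rfl⟩ ⟨z, rfl⟩ hy hz
    have hd : ∀ {y}, TowerNbr hX hτ ⟨k + 1, x⟩ ⟨k, y⟩ → NextD hX y x := by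
      intro y h
      cases h with
      | down h => exact h
    exact ((hd (hnbr hy)).rel (hd (hnbr hz))).2
  · rintro k v w ⟨x, rfl⟩ ⟨y, rfl⟩ h
    have hR : (stage hX hτ (k + 1)).R x y := by
      cases hnbr h with
      | same h => exact h
    obtain ⟨u, hx, hy, ht⟩ := hR
    exact ⟨_, ⟨u, rfl⟩, ht⟩

namespace IsLevelling

variable {k : ℕ} {v : V}

lemma singleton_mem (h : IsLevelling X τ L) (hτ : τ ∈ X.faces) (hv : L k v) :
    ({v} : Finset V) ∈ X.faces := by
  cases k with
  | zero => exact faces_mono hτ (by simpa using h.zero_iff.1 hv) (by simp)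
  | succ k =>
    obtain ⟨u, -, hu⟩ := h.exists_pred hv
    exact faces_mono hu (by simp) (by simp)

lemma singleton_mem_ballFaces (h : IsLevelling X τ L) (hτ : τ ∈ X.faces) :
    ({v} : Finset V) ∈ X.ballFaces τ k ↔ ∃ l ≤ k, L l v := by
  induction k generalizing v with
  | zero =>
    constructor
    · rintro ⟨-, hv⟩
      exact ⟨0, le_rfl, h.zero_iff.2 (by simpa using hv)⟩
    · rintro ⟨l, hl, hv⟩
      obtain rfl : l = 0 := by omega
      exact ⟨h.singleton_mem hτ hv, by simpa using h.zero_iff.1 hv⟩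
  | succ k ih =>
    constructor
    · rintro ⟨-, ρ, hρ, hvρ, w, hw, hball⟩
      obtain ⟨l, hl, hlw⟩ := ih.1 hball
      have hvρ : v ∈ ρ := by simpa using hvρ
      obtain ⟨m, hm, hml, -⟩ := h.exists_of_edge hlw (edge_of_mem hρ hw hvρ)
      exact ⟨m, by omega, hm⟩
    · rintro ⟨l, hl, hv⟩
      refine ⟨h.singleton_mem hτ hv, ?_⟩
      rcases hl.lt_or_eq with hl | rfl
      · exact ⟨{v}, h.singleton_mem hτ hv, subset_rfl, v, by simp, ih.2 ⟨l, by omega, hv⟩⟩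
      · obtain ⟨u, hu, huv⟩ := h.exists_pred hv
        exact ⟨{u, v}, huv, by simp, u, by simp, ih.2 ⟨k, le_rfl, hu⟩⟩

/-- The projection of a simplex at level `k + 1` to level `k` is nonempty. -/
lemma exists_join_pred (h : IsLevelling X τ L) (hX : LocallyKLarge 6 X) {σ : Finset V}
    (hσ : σ ∈ X.faces) (hL : ∀ v ∈ σ, L (k + 1) v) : ∃ w, L k w ∧ insert w σ ∈ X.faces := by
  obtain ⟨x, hx⟩ := X.nonempty_of_mem σ hσ
  have key : ∀ ρ ⊆ σ, ∃ w, L k w ∧ X.Tri x x w ∧ ∀ y ∈ ρ, X.Tri x y w := by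
    intro ρ
    induction ρ using Finset.induction_on with
    | empty =>
      intro _
      obtain ⟨w, hw, hwx⟩ := h.exists_pred (hL x hx)
      exact ⟨w, hw, (tri_of_edge hwx).rot, by simp⟩
    | insert z ρ hz ih =>
      intro hsub
      obtain ⟨hzσ, hsub⟩ := Finset.insert_subset_iff.1 hsub
      obtain ⟨w, hw, hxw, hy⟩ := ih hsub
      obtain ⟨w', hw', ht'⟩ := h.exists_common_pred (hL x hx) (hL z hzσ)
        (edge_of_mem hσ hx hzσ)
      have hww : X.Tri x w w' := h.tri_of_preds (hL x hx) hw hw' hxw.rot.edge ht'.swap.edge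
      by_cases hzw : X.Tri x z w
      · refine ⟨w, hw, hxw, fun y hyρ => ?_⟩
        rcases Finset.mem_insert.1 hyρ with rfl | hyρ
        · exact hzw
        · exact hy y hyρ
      · refine ⟨w', hw', tri_of_mem ht' (by simp) (by simp) (by simp), fun y hyρ => ?_⟩
        rcases Finset.mem_insert.1 hyρ with rfl | hyρ
        · exact ht'.rot
        · rcases hX.four_cycle (hy y hyρ).swap.rot
            (tri_of_mem hσ hx (hsub hyρ) hzσ) ht'.rot hww.swap.rot with hd | hd
          · exact (hzw hd.swap.rot).elim
          · exact hd
  obtain ⟨w, hw, hxw, hy⟩ := key σ subset_rfl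
  refine ⟨w, hw, hX.mem_faces_of_tri (v := x) (by simp [hx]) ?_⟩
  intro a ha b hb
  rw [Finset.mem_insert] at ha hb
  rcases ha with rfl | ha <;> rcases hb with rfl | hb
  · exact tri_of_mem hxw (by simp) (by simp) (by simp)
  · exact (hy b hb).swap.rot
  · exact hy a ha
  · exact tri_of_mem hσ hx ha hb

/-- In a chamber complex, a codimension-one simplex of a sphere has at most one extension to a
chamber of the corresponding ball. -/
lemma eq_of_insert_mem (h : IsLevelling X τ L) (hX : LocallyKLarge 6 X) (hτ : τ ∈ X.faces)
    {σ : Finset V} (hcard : ∀ ρ ∈ X.faces, ρ.card ≤ σ.card + 1) (hne : σ.Nonempty)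
    (hL : ∀ v ∈ σ, L k v) {w : V} (hvσ : v ∉ σ) (hwσ : w ∉ σ) (hv : insert v σ ∈ X.faces)
    (hw : insert w σ ∈ X.faces) (hLv : ∃ l ≤ k, L l v) (hLw : ∃ l ≤ k, L l w) : v = w := by
  by_contra hvw
  have hc : (insert v (insert w σ)).card = σ.card + 2 := by
    rw [Finset.card_insert_of_notMem (by simp [hvw, hvσ]), Finset.card_insert_of_notMem hwσ]
  obtain ⟨x, hx⟩ := hne
  suffices insert v (insert w σ) ∈ X.faces by
    have := hcard _ this
    omega
  cases k with
  | zero =>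
    obtain ⟨l, hl, hLv⟩ := hLv
    obtain ⟨m, hm, hLw⟩ := hLw
    obtain rfl : l = 0 := by omega
    obtain rfl : m = 0 := by omega
    refine faces_mono hτ ?_ (by simp)
    intro y hy
    simp only [Finset.mem_insert] at hy
    rcases hy with rfl | rfl | hy
    · exact h.zero_iff.1 hLv
    · exact h.zero_iff.1 hLw
    · exact h.zero_iff.1 (hL y hy)
  | succ k =>
    have hpred : ∀ {u}, u ∉ σ → insert u σ ∈ X.faces → (∃ l ≤ k + 1, L l u) → L k u := by
      rintro u huσ hu ⟨l, hl, hLu⟩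
      obtain ⟨m, hm, hml, hlm⟩ := h.exists_of_edge (hL x hx)
        (edge_of_mem hu (b := u) (by simp [hx]) (by simp))
      obtain rfl := h.unique hm hLu
      obtain rfl | rfl : m = k ∨ m = k + 1 := by omega
      · exact hLu
      · obtain ⟨w, hw, hface⟩ := h.exists_join_pred hX hu (k := k) (by simpa [hLu] using hL)
        have hwu : w ∉ insert u σ := by
          intro hmem
          have : L (k + 1) w := by
            rcases Finset.mem_insert.1 hmem with rfl | hmem
            · exact hLu
            · exact hL w hmem
          have := h.unique hw this
          omega
        have := hcard _ hface
        rw [Finset.card_insert_of_notMem hwu, Finset.card_insert_of_notMem huσ] at this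
        omega
    have hLv := hpred hvσ hv hLv
    have hLw := hpred hwσ hw hLw
    have hvw : X.Tri x v w := h.tri_of_preds (hL x hx) hLv hLw
      (edge_of_mem hv (b := v) (by simp [hx]) (by simp))
      (edge_of_mem hw (b := w) (by simp [hx]) (by simp))
    refine hX.mem_faces_of_tri (v := x) (by simp [hx]) ?_
    intro a ha b hb
    rw [Finset.mem_insert] at ha hb
    rcases ha with rfl | ha <;> rcases hb with rfl | hb
    · exact tri_of_mem hvw (by simp) (by simp) (by simp)
    · rcases Finset.mem_insert.1 hb with rfl | hb
      · exact hvw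
      · exact tri_of_mem hv (by simp [hx]) (by simp) (by simp [hb])
    · rcases Finset.mem_insert.1 ha with rfl | ha
      · exact hvw.swap.rot
      · exact tri_of_mem hv (by simp [hx]) (by simp [ha]) (by simp)
    · exact tri_of_mem hw (by simp [hx]) ha hb

end IsLevelling

end Levels

end SComplex

open SComplex

/-- **Lemma (Osajda, Lemma 4.2).** Let `X` be a systolic chamber complex of dimension
`n ≥ 1`, `τ` a simplex of `X` and `σ` an `(n-1)`-dimensional simplex of `S_k(τ,X)`.
Then there is a vertex `v` at combinatorial distance `k+1` from `τ` such that
`v ∗ σ` is a simplex of `X`. -/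
theorem exists_vertex_joinable_at_next_sphere {V : Type} [DecidableEq V]
    (X : SComplex V) (n : ℕ) (hn : 1 ≤ n) (hsys : X.Systolic)
    (hcc : X.IsChamberComplex n) (τ : Finset V) (hτ : τ ∈ X.faces)
    (k : ℕ) (σ : Finset V) (hσ : σ ∈ X.sphereFaces τ k) (hcard : σ.card = n) :
    ∃ v : V, ({v} : Finset V) ∈ X.ballFaces τ (k + 1) ∧
      ({v} : Finset V) ∉ X.ballFaces τ k ∧ insert v σ ∈ X.faces := by
  obtain ⟨hX, -, hsc⟩ := hsys
  obtain ⟨L, h⟩ := exists_isLevelling hX hτ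
  have hσX : σ ∈ X.faces := by cases k <;> first | exact hσ.1.1 | exact hσ.1
  have hne := X.nonempty_of_mem σ hσX
  have hL : ∀ v ∈ σ, L k v := by
    intro v hv
    cases k with
    | zero => exact h.zero_iff.2 (hσ.2 hv)
    | succ k =>
      obtain ⟨l, hl, hLv⟩ := (h.singleton_mem_ballFaces hτ).1
        ((X.ball τ (k + 1)).down_closed σ hσ.1 {v} (by simpa using hv) (by simp))
      have hlk : ¬ l ≤ k := fun hlk => hσ.2 v hv ((h.singleton_mem_ballFaces hτ).2 ⟨l, hlk, hLv⟩)
      obtain rfl : l = k + 1 := by omega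
      exact hLv
  obtain ⟨ρ₁, hρ₁, ρ₂, hρ₂, hρ, hσ₁, hσ₂, hc₁, hc₂⟩ := hcc.2.2 σ hσX hcard
  obtain ⟨v, hv, rfl⟩ := Finset.exists_eq_insert_iff.2 ⟨hσ₁, by omega⟩
  obtain ⟨w, hw, rfl⟩ := Finset.exists_eq_insert_iff.2 ⟨hσ₂, by omega⟩
  have hfar : ∃ u, insert u σ ∈ X.faces ∧ ¬ ∃ l ≤ k, L l u := by
    by_contra! hcon
    refine hρ ?_
    rw [h.eq_of_insert_mem hX hτ (by simpa [hcard] using hcc.1) hne hL hv hw hρ₁ hρ₂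
      (hcon v hρ₁) (hcon w hρ₂)]
  obtain ⟨u, hu, hlu⟩ := hfar
  refine ⟨u, ?_, fun hb => hlu ((h.singleton_mem_ballFaces hτ).1 hb), hu⟩
  obtain ⟨x, hx⟩ := hne
  obtain ⟨l, hl, hlk, -⟩ := h.exists_of_edge (hL x hx)
    (edge_of_mem hu (b := u) (by simp [hx]) (by simp))
  exact (h.singleton_mem_ballFaces hτ).2 ⟨l, hlk, hl⟩
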